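/- Let E be a measurable space, p ∈ (0,1), α a finite measure on E, and let ρ be a probability measure on Conf(E) satisfying the Papangelou identity for parameters (p, α). Let P be a Markov kernel from Conf(E) to Conf(E) that is (i) consistent: ∫(𝒜h)(ξ) P(η,dξ) = ∑_{x∈η} ∫ h(ξ) P(η−x, dξ) for every measurable h : Conf(E) → [0,∞] and every η, where (𝒜h)(η) = ∑_{x∈η} h(η−x); and (ii) reversible with respect to ρ: ∫ u(η)(∫ v dP(η,·)) ρ(dη) = ∫ (∫ u dP(η,·)) v(η) ρ(dη) for all bounded measurable u, v : Conf(E) → [0,∞). Then for all nonnegative f, g ∈ 𝒟, ∫ (k⁻(𝟙)f)(η) · (∫ g dP(η,·)) ρ(dη) = ∫ (∫ f dP(η,·)) · (k⁺(𝟙)g)(η) ρ(dη), where 𝟙 is the constant function 1 on E. -/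

import Mathlib

open MeasureTheory ProbabilityTheory
open scoped ENNReal

noncomputable section

variable {E : Type*}

/-- Number of points of the finite configuration `η` lying in `B`, counted with multiplicity. -/
def confCount (η : Multiset E) (B : Set E) : ℕ :=
  @Multiset.countP E (fun x => x ∈ B) (Classical.decPred _) η

/-- Removal of one copy of the point `x` from the configuration `η`. -/
def confDel (η : Multiset E) (x : E) : Multiset E :=
  @Multiset.erase E (Classical.decEq E) η x

/-- The σ-algebra on the configuration space generated by the counting maps. -/
instance confMeasurableSpace [MeasurableSpace E] : MeasurableSpace (Multiset E) :=
  MeasurableSpace.generateFrom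
    {S | ∃ (B : Set E) (n : ℕ), MeasurableSet B ∧ S = {η | confCount η B = n}}

/-- The raising operator `k⁺(𝟙)` acting on real-valued functions. -/
def kplusOne (p : ℝ) (F : Multiset E → ℝ) (η : Multiset E) : ℝ :=
  (Real.sqrt p)⁻¹ * (η.map (fun x => F (confDel η x))).sum

/-- The lowering operator `k⁻(𝟙)` acting on real-valued functions. -/
def kminusOne (p : ℝ) [MeasurableSpace E] (α : Measure E) (F : Multiset E → ℝ)
    (η : Multiset E) : ℝ :=
  Real.sqrt p * ((∫ x, F (x ::ₘ η) ∂α) + (η.map (fun x => F (x ::ₘ η))).sum)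

/-- `ρ` satisfies the Papangelou identity with kernel `p(α + η)`. -/
def Papangelou [MeasurableSpace E] (p : ℝ) (α : Measure E) (ρ : Measure (Multiset E)) : Prop :=
  ∀ F : E × Multiset E → ℝ≥0∞, Measurable F →
    ∫⁻ η, (η.map (fun x => F (x, η))).sum ∂ρ
      = ENNReal.ofReal p *
          ∫⁻ η, ((∫⁻ x, F (x, x ::ₘ η) ∂α) + (η.map (fun x => F (x, x ::ₘ η))).sum) ∂ρ

/-- The set `𝒟` (real, nonnegative version): bounded measurable functions supported on
configurations with a bounded number of points. -/
def memD [MeasurableSpace E] (f : Multiset E → ℝ) : Prop :=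
  Measurable f ∧ (∃ C, ∀ η, |f η| ≤ C) ∧ ∃ m : ℕ, ∀ η : Multiset E, m < Multiset.card η → f η = 0

theorem measurableSet_confCount_eq [MeasurableSpace E] {B : Set E} (hB : MeasurableSet B) (n : ℕ) :
    MeasurableSet {η : Multiset E | confCount η B = n} :=
  MeasurableSpace.measurableSet_generateFrom ⟨B, n, hB, rfl⟩

theorem measurable_confCount [MeasurableSpace E] {B : Set E} (hB : MeasurableSet B) :
    Measurable (fun η : Multiset E => confCount η B) :=
  measurable_to_countable' fun n => measurableSet_confCount_eq hB n

theorem measurable_multiset_card [MeasurableSpace E] :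
    Measurable (fun η : Multiset E => Multiset.card η) := by
  have h := measurable_confCount (E := E) MeasurableSet.univ
  simpa [confCount] using h

theorem measurable_of_confCount [MeasurableSpace E] {X : Type*} [MeasurableSpace X]
    {φ : X → Multiset E}
    (h : ∀ B, MeasurableSet B → Measurable fun x => confCount (φ x) B) : Measurable φ := by
  refine measurable_generateFrom ?_
  rintro _ ⟨B, n, hB, rfl⟩
  exact h B hB (measurableSet_singleton n)

theorem confCount_cons (x : E) (η : Multiset E) (B : Set E) :
    confCount (x ::ₘ η) B = confCount η B + B.indicator 1 x := by
  classical
  by_cases hx : x ∈ B <;> simp [confCount, hx]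

theorem cons_confDel {η : Multiset E} {x : E} (hx : x ∈ η) : x ::ₘ confDel η x = η := by
  classical
  unfold confDel
  exact Multiset.cons_erase hx

theorem confDel_cons (η : Multiset E) (x : E) : confDel (x ::ₘ η) x = η := by
  simp [confDel]

theorem measurable_cons [MeasurableSpace E] :
    Measurable fun q : E × Multiset E => q.1 ::ₘ q.2 := by
  refine measurable_of_confCount fun B hB => ?_
  simp only [confCount_cons]
  exact ((measurable_confCount hB).comp measurable_snd).add
    ((measurable_const.indicator hB).comp measurable_fst)

/-- Point removal is measurable on the set of pairs `(x, η)` with `x ∈ η`. -/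
theorem measurable_confDel_subtype [MeasurableSpace E] :
    Measurable fun q : {q : E × Multiset E // q.1 ∈ q.2} => confDel q.1.2 q.1.1 := by
  refine measurable_of_confCount fun B hB => ?_
  have h : (fun q : {q : E × Multiset E // q.1 ∈ q.2} => confCount (confDel q.1.2 q.1.1) B)
      = fun q => confCount q.1.2 B - B.indicator 1 q.1.1 := by
    funext q
    conv_rhs => rw [← cons_confDel q.2, confCount_cons]
    simp
  rw [h]
  exact ((measurable_confCount hB).comp (measurable_snd.comp measurable_subtype_coe)).sub
    ((measurable_const.indicator hB).comp (measurable_fst.comp measurable_subtype_coe))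

/-- Although `(x, η) ↦ η - x` need not be jointly measurable, it may be replaced by a measurable
function as long as `x` is a point of `η`. -/
theorem exists_measurable_eq_confDel [MeasurableSpace E] {h : Multiset E → ℝ≥0∞}
    (hh : Measurable h) :
    ∃ H : E × Multiset E → ℝ≥0∞, Measurable H ∧
      ∀ (x : E) (η : Multiset E), x ∈ η → H (x, η) = h (confDel η x) := by
  obtain ⟨H, hH, hEq⟩ := (hh.comp measurable_confDel_subtype).exists_eq_measurable_comp
  exact ⟨H, hH, fun x η hx => (congrFun hEq ⟨(x, η), hx⟩).symm⟩

/-- The counting measure of a configuration. -/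
def confMeasure [MeasurableSpace E] (η : Multiset E) : Measure E :=
  (η.map Measure.dirac).sum

theorem lintegral_confMeasure [MeasurableSpace E] (η : Multiset E) {u : E → ℝ≥0∞}
    (hu : Measurable u) : ∫⁻ x, u x ∂(confMeasure η) = (η.map u).sum := by
  induction η using Multiset.induction with
  | empty => simp [confMeasure]
  | cons a s ih =>
    simp only [confMeasure, Multiset.map_cons, Multiset.sum_cons] at ih ⊢
    rw [lintegral_add_measure, lintegral_dirac' _ hu, ih]

theorem confMeasure_apply [MeasurableSpace E] (η : Multiset E) {B : Set E}
    (hB : MeasurableSet B) : confMeasure η B = confCount η B := by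
  classical
  induction η using Multiset.induction with
  | empty => simp [confMeasure, confCount]
  | cons a s ih =>
    rw [confCount_cons, Nat.cast_add, ← ih, add_comm]
    by_cases ha : a ∈ B <;> simp [confMeasure, hB, ha]

theorem measurable_confMeasure [MeasurableSpace E] :
    Measurable (confMeasure : Multiset E → Measure E) := by
  refine Measure.measurable_of_measurable_coe _ fun B hB => ?_
  simp only [confMeasure_apply _ hB]
  exact (measurable_from_top (f := fun n : ℕ => (n : ℝ≥0∞))).comp (measurable_confCount hB)

/-- The kernel sending a configuration to the uniform distribution on its points. -/
def confKernel (E : Type*) [MeasurableSpace E] : Kernel (Multiset E) E where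
  toFun η := (Multiset.card η : ℝ≥0∞)⁻¹ • confMeasure η
  measurable' := by
    refine Measure.measurable_of_measurable_coe _ fun B hB => ?_
    simp only [Measure.smul_apply, smul_eq_mul]
    exact ((measurable_from_top (f := fun n : ℕ => (n : ℝ≥0∞)⁻¹)).comp
      measurable_multiset_card).mul
      ((Measure.measurable_coe hB).comp measurable_confMeasure)

instance [MeasurableSpace E] : IsFiniteKernel (confKernel E) := by
  refine ⟨1, ENNReal.one_lt_top, fun η => ?_⟩
  change (Multiset.card η : ℝ≥0∞)⁻¹ * confMeasure η Set.univ ≤ 1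
  rw [confMeasure_apply _ MeasurableSet.univ]
  simp [confCount, ENNReal.inv_mul_le_one]

theorem measurable_multiset_sum_map [MeasurableSpace E] {F : E × Multiset E → ℝ≥0∞}
    (hF : Measurable F) :
    Measurable fun η : Multiset E => (η.map fun x => F (x, η)).sum := by
  have h : (fun η : Multiset E => (η.map fun x => F (x, η)).sum)
      = fun η => (Multiset.card η : ℝ≥0∞) * ∫⁻ x, F (x, η) ∂(confKernel E η) := by
    funext η
    change _ = _ * ∫⁻ x, F (x, η) ∂((Multiset.card η : ℝ≥0∞)⁻¹ • confMeasure η)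
    rw [lintegral_smul_measure, lintegral_confMeasure η (u := fun x => F (x, η)) (hF.comp measurable_prodMk_right),
      smul_eq_mul, ← mul_assoc]
    rcases Multiset.empty_or_exists_mem η with rfl | ⟨a, ha⟩
    · simp
    · have hη : η ≠ 0 := fun h => Multiset.notMem_zero a (h ▸ ha)
      rw [ENNReal.mul_inv_cancel, one_mul]
      · simpa using hη
      · exact ENNReal.natCast_ne_top _
  rw [h]
  refine ((measurable_from_top (f := fun n : ℕ => (n : ℝ≥0∞))).comp
    measurable_multiset_card).mul ?_
  exact Measurable.lintegral_kernel_prod_right (f := fun η x => F (x, η))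
    (hF.comp measurable_swap)

theorem measurable_sum_confDel [MeasurableSpace E] {h : Multiset E → ℝ≥0∞}
    (hh : Measurable h) :
    Measurable fun η : Multiset E => (η.map fun x => h (confDel η x)).sum := by
  obtain ⟨H, hH, hEq⟩ := exists_measurable_eq_confDel hh
  convert measurable_multiset_sum_map hH using 3 with η
  exact Multiset.map_congr rfl fun x hx => (hEq x η hx).symm

theorem ofReal_multiset_sum_map {X : Type*} (s : Multiset X) {u : X → ℝ} (hu : ∀ x, 0 ≤ u x) :
    ENNReal.ofReal (s.map u).sum = (s.map fun x => ENNReal.ofReal (u x)).sum := by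
  induction s using Multiset.induction with
  | empty => simp
  | cons a s ih =>
    have : 0 ≤ (s.map u).sum := Multiset.sum_nonneg (by simpa using fun x _ => hu x)
    simp [ENNReal.ofReal_add (hu a) this, ih]

/-- The integral form of the adjointness of the two operators under the Papangelou identity. -/
theorem Papangelou.lintegral_mul_sum_confDel [MeasurableSpace E] {p : ℝ} {α : Measure E}
    {ρ : Measure (Multiset E)} (hρ : Papangelou p α ρ) {f h : Multiset E → ℝ≥0∞}
    (hf : Measurable f) (hh : Measurable h) :
    ∫⁻ η, f η * (η.map fun x => h (confDel η x)).sum ∂ρ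
      = ENNReal.ofReal p *
        ∫⁻ η, ((∫⁻ x, f (x ::ₘ η) ∂α) + (η.map fun x => f (x ::ₘ η)).sum) * h η ∂ρ := by
  obtain ⟨H, hH, hEq⟩ := exists_measurable_eq_confDel hh
  have key := hρ (fun q => f q.2 * H q) ((hf.comp measurable_snd).mul hH)
  have hL : ∀ η : Multiset E, (η.map fun x => f η * H (x, η)).sum
      = f η * (η.map fun x => h (confDel η x)).sum := fun η => by
    rw [← Multiset.sum_map_mul_left]
    exact congrArg _ (Multiset.map_congr rfl fun x hx => by rw [hEq x η hx])
  have hc : ∀ (x : E) (η : Multiset E), H (x, x ::ₘ η) = h η := fun x η => by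
    rw [hEq _ _ (Multiset.mem_cons_self x η), confDel_cons]
  have hR : ∀ η : Multiset E,
      (∫⁻ x, f (x ::ₘ η) * h η ∂α) + (η.map fun x => f (x ::ₘ η) * h η).sum
      = ((∫⁻ x, f (x ::ₘ η) ∂α) + (η.map fun x => f (x ::ₘ η)).sum) * h η := fun η => by
    rw [lintegral_mul_const _ (f := fun x => f (x ::ₘ η))
      (hf.comp (measurable_cons.comp measurable_prodMk_right)),
      Multiset.sum_map_mul_right, add_mul]
  simpa only [hL, hc, hR] using key

theorem memD.exists_sum_confDel_le [MeasurableSpace E] {g : Multiset E → ℝ} (hg : memD g)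
    (hg0 : ∀ η, 0 ≤ g η) :
    ∃ C, ∀ η : Multiset E, |(η.map fun x => g (confDel η x)).sum| ≤ C := by
  obtain ⟨-, ⟨C, hC⟩, m, hm⟩ := hg
  have hC0 : 0 ≤ C := (abs_nonneg _).trans (hC 0)
  refine ⟨(m + 1) * C, fun η => ?_⟩
  rw [abs_of_nonneg (Multiset.sum_nonneg (by simpa using fun x _ => hg0 _))]
  by_cases h : Multiset.card η ≤ m + 1
  · calc (η.map fun x => g (confDel η x)).sum
        ≤ Multiset.card (η.map fun x => g (confDel η x)) • C :=
          Multiset.sum_le_card_nsmul _ _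
            (by simpa using fun x _ => (le_abs_self _).trans (hC (confDel η x)))
      _ ≤ (m + 1) * C := by
          rw [Multiset.card_map, nsmul_eq_mul]
          gcongr
          exact_mod_cast h
  · have h0 : ∀ y ∈ η.map fun x => g (confDel η x), y = 0 := by
      intro y hy
      obtain ⟨x, hx, rfl⟩ := Multiset.mem_map.1 hy
      refine hm _ ?_
      have := congrArg Multiset.card (cons_confDel hx)
      rw [Multiset.card_cons] at this
      omega
    rw [Multiset.sum_eq_zero h0]
    positivity

theorem ofReal_integral_of_nonneg_bounded {X : Type*} [MeasurableSpace X] (μ : Measure X)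
    [IsFiniteMeasure μ] {u : X → ℝ} (hu : Measurable u) (hu0 : ∀ x, 0 ≤ u x)
    (hC : ∃ C, ∀ x, |u x| ≤ C) :
    ENNReal.ofReal (∫ x, u x ∂μ) = ∫⁻ x, ENNReal.ofReal (u x) ∂μ := by
  obtain ⟨C, hC⟩ := hC
  exact ofReal_integral_eq_lintegral_ofReal
    (Integrable.of_bound hu.aestronglyMeasurable C (.of_forall hC)) (.of_forall hu0)

/-- for a consistent Markov kernel `P`, reversible with respect to a measure `ρ`
satisfying the Papangelou identity, one has
`∫ (k⁻(𝟙)f) (Pg) dρ = ∫ (Pf) (k⁺(𝟙)g) dρ` for nonnegative `f, g ∈ 𝒟`. -/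
theorem kminus_P_adjoint_kplus [MeasurableSpace E] (p : ℝ) (hp : p ∈ Set.Ioo (0 : ℝ) 1)
    (α : Measure E) [IsFiniteMeasure α] (ρ : Measure (Multiset E)) [IsProbabilityMeasure ρ]
    (hρ : Papangelou p α ρ)
    (P : Kernel (Multiset E) (Multiset E)) [IsMarkovKernel P]
    (hcons : ∀ h : Multiset E → ℝ≥0∞, Measurable h → ∀ η : Multiset E,
      ∫⁻ ξ, (ξ.map (fun x => h (confDel ξ x))).sum ∂(P η)
        = (η.map (fun x => ∫⁻ ξ, h ξ ∂(P (confDel η x)))).sum)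
    (hrev : ∀ u v : Multiset E → ℝ, Measurable u → Measurable v →
      (∀ η, 0 ≤ u η) → (∀ η, 0 ≤ v η) → (∃ C, ∀ η, |u η| ≤ C) → (∃ C, ∀ η, |v η| ≤ C) →
      ∫ η, u η * (∫ ξ, v ξ ∂(P η)) ∂ρ = ∫ η, (∫ ξ, u ξ ∂(P η)) * v η ∂ρ)
    (f g : Multiset E → ℝ) (hf : memD f) (hg : memD g)
    (hf0 : ∀ η, 0 ≤ f η) (hg0 : ∀ η, 0 ≤ g η) :
    ∫ η, kminusOne p α f η * (∫ ξ, g ξ ∂(P η)) ∂ρ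
      = ∫ η, (∫ ξ, f ξ ∂(P η)) * kplusOne p g η ∂ρ := by
  obtain ⟨hp0, -⟩ := hp
  have hfm := hf.1
  have hgm := hg.1
  have hf' : Measurable fun η => ENNReal.ofReal (f η) := hfm.ennreal_ofReal
  have hg' : Measurable fun η => ENNReal.ofReal (g η) := hgm.ennreal_ofReal
  have hsum0 : ∀ η : Multiset E, 0 ≤ (η.map fun x => g (confDel η x)).sum := fun η =>
    Multiset.sum_nonneg (by simpa using fun x _ => hg0 _)
  have hAeq : ∀ η : Multiset E, ENNReal.ofReal (η.map fun x => g (confDel η x)).sum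
      = (η.map fun x => ENNReal.ofReal (g (confDel η x))).sum := fun η =>
    ofReal_multiset_sum_map η fun x => hg0 _
  have hAm : Measurable fun η : Multiset E => (η.map fun x => g (confDel η x)).sum := by
    convert (measurable_sum_confDel hg').ennreal_toReal using 2 with η
    rw [← hAeq, ENNReal.toReal_ofReal (hsum0 η)]
  have hAb := hg.exists_sum_confDel_le hg0
  have hGm : Measurable fun η => ∫⁻ ξ, ENNReal.ofReal (g ξ) ∂(P η) := hg'.lintegral_kernel
  have hG : ∀ η, ENNReal.ofReal (∫ ξ, g ξ ∂(P η)) = ∫⁻ ξ, ENNReal.ofReal (g ξ) ∂(P η) :=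
    fun η => ofReal_integral_of_nonneg_bounded _ hgm hg0 hg.2.1
  have hPm : ∀ {u : Multiset E → ℝ}, Measurable u →
      Measurable fun η => ∫ ξ, u ξ ∂(P η) := fun hu =>
    hu.stronglyMeasurable.integral_kernel.measurable
  have hs0 : 0 < √p := Real.sqrt_pos.2 hp0
  have hK0 : ∀ η : Multiset E,
      0 ≤ (∫ x, f (x ::ₘ η) ∂α) + (η.map fun x => f (x ::ₘ η)).sum := fun η =>
    add_nonneg (integral_nonneg fun x => hf0 _)
      (Multiset.sum_nonneg (by simpa using fun x _ => hf0 _))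
  have hK : ∀ η : Multiset E,
      ENNReal.ofReal ((∫ x, f (x ::ₘ η) ∂α) + (η.map fun x => f (x ::ₘ η)).sum)
        = (∫⁻ x, ENNReal.ofReal (f (x ::ₘ η)) ∂α)
          + (η.map fun x => ENNReal.ofReal (f (x ::ₘ η))).sum := fun η => by
    rw [ENNReal.ofReal_add (integral_nonneg fun x => hf0 _)
      (Multiset.sum_nonneg (by simpa using fun x _ => hf0 _)),
      ofReal_multiset_sum_map η fun x => hf0 _,
      ofReal_integral_of_nonneg_bounded α (u := fun x => f (x ::ₘ η))
        (hfm.comp (measurable_cons.comp measurable_prodMk_right)) (fun x => hf0 _)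
        (hf.2.1.imp fun C hC x => hC _)]
  have hKm : Measurable fun η : Multiset E =>
      (∫ x, f (x ::ₘ η) ∂α) + (η.map fun x => f (x ::ₘ η)).sum := by
    have hm : Measurable fun η : Multiset E => (∫⁻ x, ENNReal.ofReal (f (x ::ₘ η)) ∂α)
          + (η.map fun x => ENNReal.ofReal (f (x ::ₘ η))).sum :=
      (hf'.comp measurable_cons).lintegral_prod_left'.add
        (measurable_multiset_sum_map (hf'.comp measurable_cons))
    convert hm.ennreal_toReal using 2 with η
    rw [← hK, ENNReal.toReal_ofReal (hK0 η)]
  have hPap : p * ∫ η : Multiset E, ((∫ x, f (x ::ₘ η) ∂α) + (η.map fun x => f (x ::ₘ η)).sum)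
        * (∫ ξ, g ξ ∂(P η)) ∂ρ
      = ∫ η, f η * (∫ ξ, (ξ.map fun x => g (confDel ξ x)).sum ∂(P η)) ∂ρ := by
    have key := hρ.lintegral_mul_sum_confDel hf' hGm
    simp only [← hcons _ hg'] at key
    rw [integral_eq_lintegral_of_nonneg_ae
        (.of_forall fun η => mul_nonneg (hK0 η) (integral_nonneg hg0))
        (hKm.mul (hPm hgm)).aestronglyMeasurable,
      integral_eq_lintegral_of_nonneg_ae
        (.of_forall fun η => mul_nonneg (hf0 η) (integral_nonneg hsum0))
        (hfm.mul (hPm hAm)).aestronglyMeasurable]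
    simp only [ENNReal.ofReal_mul (hK0 _), ENNReal.ofReal_mul (hf0 _), hK, hG,
      ofReal_integral_of_nonneg_bounded _ hAm hsum0 hAb, hAeq]
    rw [key, ENNReal.toReal_mul, ENNReal.toReal_ofReal hp0.le]
  have hR := hrev f _ hfm hAm hf0 hsum0 hf.2.1 hAb
  rw [← hPap] at hR
  simp only [kminusOne, kplusOne, mul_assoc, mul_left_comm _ (√p)⁻¹ _, integral_const_mul]
  rw [← hR, ← mul_assoc]
  congr 1
  rw [eq_inv_mul_iff_mul_eq₀ hs0.ne', Real.mul_self_sqrt hp0.le]
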